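/- arXiv:2508.08633 — 3 statements merged into one kernel-verified Lean document; each statement's English description precedes it below -/
import Mathlib

section
/- Let P be a positive normal program, i.e., every rule of P has a singleton head and an empty negative body. Then every subset D ⊆ HU(P) is a safe diminution of P. -/
namespace ASP

/-- A ground rule over a type `A` of ground atoms: finite sets of head,
positive-body, and negative-body atoms. -/
structure GRule (A : Type*) where
  head : Set A
  pos : Set A
  neg : Set A
  head_fin : head.Finite
  pos_fin : pos.Finite
  neg_fin : neg.Finite

/-- An interpretation `I` satisfies a ground rule `r`. -/
def Satisfies {A : Type*} (I : Set A) (r : GRule A) : Prop :=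
  (r.pos ⊆ I ∧ r.neg ∩ I = ∅) → (r.head ∩ I).Nonempty

/-- `I` is a model of the ground program `Q`. -/
def IsModel {A : Type*} (I : Set A) (Q : Set (GRule A)) : Prop :=
  ∀ r ∈ Q, Satisfies I r

/-- The GL reduct of `Q` relative to `S`. -/
def reduct {A : Type*} (Q : Set (GRule A)) (S : Set A) : Set (GRule A) :=
  {r' | ∃ r ∈ Q, r.neg ∩ S = ∅ ∧
    r' = ⟨r.head, r.pos, ∅, r.head_fin, r.pos_fin, Set.finite_empty⟩}

/-- `S` is an answer set of `Q`: a ⊆-minimal model of the reduct `Q^S`. -/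
def IsAnswerSet {A : Type*} (Q : Set (GRule A)) (S : Set A) : Prop :=
  IsModel S (reduct Q S) ∧ ∀ T, IsModel T (reduct Q S) → T ⊆ S → T = S

/-- The set of answer sets of `Q`. -/
def AS {A : Type*} (Q : Set (GRule A)) : Set (Set A) :=
  {S | IsAnswerSet Q S}

/-- All atoms occurring in a ground rule. -/
def ruleAtoms {A : Type*} (r : GRule A) : Set A :=
  r.head ∪ r.pos ∪ r.neg

/-- An atom over predicate symbols `PSym`, constants `C`, and variables `V`:
a predicate symbol applied to a tuple of terms (a term is a constant or a variable). -/
abbrev VAtom (C V PSym : Type*) := PSym × List (C ⊕ V)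

/-- A ground atom: a predicate symbol applied to a tuple of constants. -/
abbrev GAtom (C PSym : Type*) := PSym × List C

/-- Constants occurring in an atom. -/
def atomConsts {C V PSym : Type*} (a : VAtom C V PSym) : Set C :=
  {c | Sum.inl c ∈ a.2}

/-- Variables occurring in an atom. -/
def atomVars {C V PSym : Type*} (a : VAtom C V PSym) : Set V :=
  {v | Sum.inr v ∈ a.2}

/-- Constants occurring in a rule. -/
def ruleConsts {C V PSym : Type*} (r : GRule (VAtom C V PSym)) : Set C :=
  ⋃ a ∈ ruleAtoms r, atomConsts a

/-- Variables occurring in a rule. -/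
def ruleVars {C V PSym : Type*} (r : GRule (VAtom C V PSym)) : Set V :=
  ⋃ a ∈ ruleAtoms r, atomVars a

/-- The Herbrand universe of a program: all constants occurring in it. -/
def HU {C V PSym : Type*} (P : Set (GRule (VAtom C V PSym))) : Set C :=
  ⋃ r ∈ P, ruleConsts r

/-- Ground an atom by substituting constants for variables. -/
def groundAtom {C V PSym : Type*} (σ : V → C) (a : VAtom C V PSym) : GAtom C PSym :=
  (a.1, a.2.map (Sum.elim id σ))

/-- Ground a rule by substituting constants for variables. -/
def groundRule {C V PSym : Type*} (σ : V → C) (r : GRule (VAtom C V PSym)) :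
    GRule (GAtom C PSym) :=
  ⟨groundAtom σ '' r.head, groundAtom σ '' r.pos, groundAtom σ '' r.neg,
    r.head_fin.image _, r.pos_fin.image _, r.neg_fin.image _⟩

/-- `P|_D`: the grounding of program `P` over the set `D` of constants,
obtained by substituting a constant of `D` for each variable of a rule. -/
def groundOn {C V PSym : Type*} (P : Set (GRule (VAtom C V PSym))) (D : Set C) :
    Set (GRule (GAtom C PSym)) :=
  {gr | ∃ r ∈ P, ∃ σ : V → C, (∀ v ∈ ruleVars r, σ v ∈ D) ∧ gr = groundRule σ r}

/-- `D` is an admissible diminution of `P`: every answer set of `P|_D`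
is contained in some answer set of `P|_{HU(P)}`. -/
def Admissible {C V PSym : Type*} (P : Set (GRule (VAtom C V PSym))) (D : Set C) : Prop :=
  ∀ ID ∈ AS (groundOn P D), ∃ I ∈ AS (groundOn P (HU P)), ID ⊆ I

/-- `D` is a safe diminution of `P`: admissible, and every answer set of
`P|_{HU(P)}` contains some answer set of `P|_D`. -/
def SafeDim {C V PSym : Type*} (P : Set (GRule (VAtom C V PSym))) (D : Set C) : Prop :=
  Admissible P D ∧
  ∀ I ∈ AS (groundOn P (HU P)), ∃ ID ∈ AS (groundOn P D), ID ⊆ I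

/-- The intersection of all models of `Q`; for positive normal `Q` it is the least model. -/
def leastModel {A : Type*} (Q : Set (GRule A)) : Set A :=
  ⋂₀ {I | IsModel I Q}

/-- Every rule of `Q` has a singleton head and an empty negative body. -/
def IsPositiveNormal {A : Type*} (Q : Set (GRule A)) : Prop :=
  ∀ r ∈ Q, (∃ a, r.head = {a}) ∧ r.neg = ∅

theorem leastModel_subset {A : Type*} {Q : Set (GRule A)} {I : Set A} (hI : IsModel I Q) :
    leastModel Q ⊆ I :=
  Set.sInter_subset_of_mem hI

theorem IsModel.anti {A : Type*} {Q R : Set (GRule A)} {I : Set A} (hI : IsModel I R)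
    (hQR : Q ⊆ R) : IsModel I Q :=
  fun r hr => hI r (hQR hr)

theorem leastModel_mono {A : Type*} {Q R : Set (GRule A)} (hQR : Q ⊆ R) :
    leastModel Q ⊆ leastModel R :=
  Set.sInter_subset_sInter fun _ hI => IsModel.anti hI hQR

theorem IsPositiveNormal.isModel_leastModel {A : Type*} {Q : Set (GRule A)}
    (hQ : IsPositiveNormal Q) : IsModel (leastModel Q) Q := by
  rintro r hr ⟨hpos, -⟩
  obtain ⟨⟨a, ha⟩, hneg⟩ := hQ r hr
  refine ⟨a, by simp [ha], fun I hI => ?_⟩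
  obtain ⟨b, hb, hbI⟩ := hI r hr ⟨hpos.trans (leastModel_subset hI), by simp [hneg]⟩
  rw [ha, Set.mem_singleton_iff] at hb
  exact hb ▸ hbI

theorem IsPositiveNormal.reduct_eq {A : Type*} {Q : Set (GRule A)}
    (hQ : IsPositiveNormal Q) (S : Set A) : reduct Q S = Q := by
  have key : ∀ r ∈ Q, r = ⟨r.head, r.pos, ∅, r.head_fin, r.pos_fin, Set.finite_empty⟩ := by
    rintro ⟨h, p, n, _, _, _⟩ hr
    obtain rfl : n = ∅ := (hQ _ hr).2
    rfl
  ext r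
  constructor
  · rintro ⟨r, hr, -, rfl⟩
    rwa [← key r hr]
  · intro hr
    exact ⟨r, hr, by simp [(hQ r hr).2], key r hr⟩

theorem IsPositiveNormal.AS_eq {A : Type*} {Q : Set (GRule A)} (hQ : IsPositiveNormal Q) :
    AS Q = {leastModel Q} := by
  ext S
  simp only [AS, IsAnswerSet, hQ.reduct_eq, Set.mem_ofPred_eq, Set.mem_singleton_iff]
  constructor
  · rintro ⟨hS, hmin⟩
    exact (hmin _ hQ.isModel_leastModel (leastModel_subset hS)).symm
  · rintro rfl
    exact ⟨hQ.isModel_leastModel, fun T hT hTS => hTS.antisymm (leastModel_subset hT)⟩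

theorem IsPositiveNormal.groundOn {C V PSym : Type*} {P : Set (GRule (VAtom C V PSym))}
    (hP : IsPositiveNormal P) (D : Set C) : IsPositiveNormal (groundOn P D) := by
  rintro _ ⟨r, hr, σ, -, rfl⟩
  obtain ⟨⟨a, ha⟩, hneg⟩ := hP r hr
  exact ⟨⟨groundAtom σ a, by simp [groundRule, ha]⟩, by simp [groundRule, hneg]⟩

theorem groundOn_mono {C V PSym : Type*} (P : Set (GRule (VAtom C V PSym))) {D E : Set C}
    (hDE : D ⊆ E) : groundOn P D ⊆ groundOn P E := by
  rintro _ ⟨r, hr, σ, hσ, rfl⟩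
  exact ⟨r, hr, σ, fun v hv => hDE (hσ v hv), rfl⟩

/-- For a positive normal program `P` (every rule has a singleton head and an empty
negative body), every subset `D ⊆ HU(P)` is a safe diminution of `P`. -/
theorem positive_normal_every_subset_safe
    {C V PSym : Type*} [Finite C] [Nonempty C] [Finite PSym]
    (P : Set (GRule (VAtom C V PSym))) (hP : P.Finite)
    (hpos : ∀ r ∈ P, (∃ a, r.head = {a}) ∧ r.neg = ∅)
    (D : Set C) (hD : D ⊆ HU P) :
    SafeDim P D := by
  have hP' : IsPositiveNormal P := hpos
  have hle := leastModel_mono (groundOn_mono P hD)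
  simpa [SafeDim, Admissible, (hP'.groundOn D).AS_eq, (hP'.groundOn (HU P)).AS_eq] using hle

end ASP
end

section
/- Let P be a program, D ⊆ HU(P), and let U be the set of ground atoms occurring in P|_D. Suppose (i) U is a splitting set of P|_{HU(P)}, i.e., for every rule r ∈ P|_{HU(P)} with head(r) ∩ U ≠ ∅, all atoms occurring in r belong to U; (ii) P|_D = {r ∈ P|_{HU(P)} : all atoms occurring in r belong to U}; and (iii) D is an admissible diminution of P. Then D is a safe diminution of P; in particular, for every answer set I of P|_{HU(P)}, the restriction I ∩ U is an answer set of P|_D. -/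
namespace ASP

theorem isModel_reduct_iff {A : Type*} {Q : Set (GRule A)} {S T : Set A} :
    IsModel T (reduct Q S) ↔
      ∀ r ∈ Q, r.neg ∩ S = ∅ → r.pos ⊆ T → (r.head ∩ T).Nonempty := by
  constructor
  · intro h r hr hn hp
    exact h ⟨r.head, r.pos, ∅, r.head_fin, r.pos_fin, Set.finite_empty⟩ ⟨r, hr, hn, rfl⟩
      ⟨hp, Set.empty_inter _⟩
  · rintro h _ ⟨r, hr, hn, rfl⟩ ⟨hp, -⟩
    exact h r hr hn hp

/-- One direction of the splitting set theorem: an answer set restricted to a splitting set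
is an answer set of the bottom part of the program. -/
theorem IsAnswerSet.inter_splitting {A : Type*} {Q : Set (GRule A)} {U I : Set A}
    (hsplit : ∀ r ∈ Q, (r.head ∩ U).Nonempty → ruleAtoms r ⊆ U) (hI : IsAnswerSet Q I) :
    IsAnswerSet {r ∈ Q | ruleAtoms r ⊆ U} (I ∩ U) := by
  obtain ⟨hmod, hmin⟩ := hI
  rw [isModel_reduct_iff] at hmod
  have neg_inter : ∀ r : GRule A, ruleAtoms r ⊆ U → r.neg ∩ (I ∩ U) = r.neg ∩ I := by
    intro r hr
    have hn : r.neg ⊆ U := fun a ha => hr (Or.inr ha)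
    rw [← Set.inter_assoc, Set.inter_right_comm, Set.inter_eq_left.mpr hn]
  refine ⟨isModel_reduct_iff.mpr ?_, fun T hT hTI => ?_⟩
  · rintro r ⟨hr, hrU⟩ hn hp
    rw [neg_inter r hrU] at hn
    obtain ⟨a, hah, haI⟩ := hmod r hr hn (hp.trans Set.inter_subset_left)
    exact ⟨a, hah, haI, hrU (Or.inl (Or.inl hah))⟩
  · rw [isModel_reduct_iff] at hT
    have hsub : T ∪ I \ U ⊆ I :=
      Set.union_subset (hTI.trans Set.inter_subset_left) Set.sdiff_subset
    have heq : T ∪ I \ U = I := by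
      refine hmin _ (isModel_reduct_iff.mpr fun r hr hn hp => ?_) hsub
      by_cases hrU : ruleAtoms r ⊆ U
      · have hpT : r.pos ⊆ T := fun a ha =>
          (hp ha).resolve_right fun h => h.2 (hrU (Or.inl (Or.inr ha)))
        obtain ⟨a, hah, haT⟩ := hT r ⟨hr, hrU⟩ ((neg_inter r hrU).trans hn) hpT
        exact ⟨a, hah, Or.inl haT⟩
      · obtain ⟨a, hah, haI⟩ := hmod r hr hn (hp.trans hsub)
        exact ⟨a, hah, Or.inr ⟨haI, fun haU => hrU (hsplit r hr ⟨a, hah, haU⟩)⟩⟩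
    refine hTI.antisymm fun a ha => ?_
    have haT : a ∈ T ∪ I \ U := heq.symm ▸ ha.1
    exact haT.resolve_right fun h => h.2 ha.2

/-- Splitting-safe diminutions are safe: if the set `U` of ground atoms occurring in
`P|_D` is a splitting set of `P|_{HU(P)}`, `P|_D` is exactly the set of rules of
`P|_{HU(P)}` all of whose atoms lie in `U`, and `D` is an admissible diminution of
`P`, then `D` is a safe diminution of `P`; moreover for every answer set `I` of
`P|_{HU(P)}`, the restriction `I ∩ U` is an answer set of `P|_D`. -/
theorem splitting_safe_diminution
    {C V PSym : Type*} [Finite C] [Nonempty C] [Finite PSym]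
    (P : Set (GRule (VAtom C V PSym))) (hP : P.Finite)
    (D : Set C) (hD : D ⊆ HU P)
    (U : Set (GAtom C PSym))
    (hU : U = ⋃ r ∈ groundOn P D, ruleAtoms r)
    (hsplit : ∀ r ∈ groundOn P (HU P),
      (r.head ∩ U).Nonempty → ruleAtoms r ⊆ U)
    (hbot : groundOn P D = {r ∈ groundOn P (HU P) | ruleAtoms r ⊆ U})
    (hadm : Admissible P D) :
    SafeDim P D ∧
    ∀ I ∈ AS (groundOn P (HU P)), IsAnswerSet (groundOn P D) (I ∩ U) := by
  have key : ∀ I ∈ AS (groundOn P (HU P)), IsAnswerSet (groundOn P D) (I ∩ U) := by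
    intro I hI
    rw [hbot]
    exact IsAnswerSet.inter_splitting hsplit hI
  exact ⟨⟨hadm, fun I hI => ⟨I ∩ U, key I hI, Set.inter_subset_left⟩⟩, key⟩

end ASP
end

section
/- There exist normal programs P₁ and P₂ with the same Herbrand universe and with identical full groundings (P₁|_{HU(P₁)} = P₂|_{HU(P₂)}, hence the two groundings are strongly equivalent), and a set D ⊆ HU(P₁) of constants, such that D is an admissible diminution of P₁ but D is not an admissible diminution of P₂. -/
namespace ASP

/-- The fact `a ←`. -/
def factRule {A : Type*} (a : A) : GRule A :=
  ⟨{a}, ∅, ∅, Set.finite_singleton a, Set.finite_empty, Set.finite_empty⟩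

/-- The rule `a ← not b`. -/
def defaultRule {A : Type*} (a b : A) : GRule A :=
  ⟨{a}, ∅, {b}, Set.finite_singleton a, Set.finite_empty, Set.finite_singleton b⟩

theorem groundRule_factRule {C V PSym : Type*} (σ : V → C) (a : VAtom C V PSym) :
    groundRule σ (factRule a) = factRule (groundAtom σ a) := by
  simp [groundRule, factRule]

theorem groundRule_defaultRule {C V PSym : Type*} (σ : V → C) (a b : VAtom C V PSym) :
    groundRule σ (defaultRule a b) = defaultRule (groundAtom σ a) (groundAtom σ b) := by
  simp [groundRule, defaultRule]

theorem ruleVars_factRule {C V PSym : Type*} (a : VAtom C V PSym) :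
    ruleVars (factRule a) = atomVars a := by
  simp [ruleVars, ruleAtoms, factRule]

theorem ruleVars_defaultRule {C V PSym : Type*} (a b : VAtom C V PSym) :
    ruleVars (defaultRule a b) = atomVars a ∪ atomVars b := by
  ext v
  simp [ruleVars, ruleAtoms, defaultRule, or_comm]

/-- The ground program `{q(0) ← not p(1)} ∪ {p(c) ← | c ∈ D}`, where `p` is `true` and `q` is
`false`. -/
def groundExample (D : Set (Fin 3)) : Set (GRule (GAtom (Fin 3) Bool)) :=
  insert (defaultRule (false, [0]) (true, [1])) ((fun c => factRule (true, [c])) '' D)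

theorem isModel_reduct_groundExample_iff {D : Set (Fin 3)} {S T : Set (GAtom (Fin 3) Bool)} :
    IsModel T (reduct (groundExample D) S) ↔
      ((true, [1]) ∉ S → (false, [0]) ∈ T) ∧ ∀ c ∈ D, (true, [c]) ∈ T := by
  simp [isModel_reduct_iff, groundExample, defaultRule, factRule]

/-- The program consisting of `q(0) ← not p(1)`, `p(0) ←` and `p(1) ←`. -/
def constantProgram : Set (GRule (VAtom (Fin 3) Unit Bool)) :=
  {defaultRule (false, [Sum.inl 0]) (true, [Sum.inl 1]),
    factRule (true, [Sum.inl 0]), factRule (true, [Sum.inl 1])}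

/-- The program consisting of `q(0) ← not p(1)` and `p(X) ←`. -/
def variableProgram : Set (GRule (VAtom (Fin 3) Unit Bool)) :=
  {defaultRule (false, [Sum.inl 0]) (true, [Sum.inl 1]), factRule (true, [Sum.inr ()])}

theorem HU_constantProgram : HU constantProgram = {0, 1} := by
  ext c
  simp [HU, constantProgram, ruleConsts, ruleAtoms, atomConsts, defaultRule, factRule, or_comm]

theorem HU_variableProgram : HU variableProgram = {0, 1} := by
  ext c
  simp [HU, variableProgram, ruleConsts, ruleAtoms, atomConsts, defaultRule, factRule, or_comm]

theorem groundOn_constantProgram (D : Set (Fin 3)) :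
    groundOn constantProgram D = groundExample {0, 1} := by
  ext r
  simp [groundOn, constantProgram, groundExample, groundRule_factRule, groundRule_defaultRule,
    ruleVars_factRule, ruleVars_defaultRule, groundAtom, atomVars, eq_comm]

theorem groundOn_variableProgram (D : Set (Fin 3)) :
    groundOn variableProgram D = groundExample D := by
  ext r
  have hsubst : (∃ σ : Unit → Fin 3, σ () ∈ D ∧ factRule (true, [σ ()]) = r) ↔
      ∃ c ∈ D, factRule (true, [c]) = r :=
    ⟨fun ⟨σ, h⟩ => ⟨σ (), h⟩, fun ⟨c, h⟩ => ⟨fun _ => c, h⟩⟩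
  simpa [groundOn, variableProgram, groundExample, groundRule_factRule, groundRule_defaultRule,
    ruleVars_factRule, ruleVars_defaultRule, groundAtom, atomVars, eq_comm]
    using or_congr_right hsubst

theorem admissible_constantProgram (D : Set (Fin 3)) : Admissible constantProgram D := by
  intro I hI
  rw [groundOn_constantProgram] at hI
  exact ⟨I, by rwa [groundOn_constantProgram], subset_rfl⟩

theorem isAnswerSet_groundExample_zero :
    IsAnswerSet (groundExample {0}) {(false, [0]), (true, [0])} := by
  simp only [IsAnswerSet, isModel_reduct_groundExample_iff]
  refine ⟨by simp, fun T hT hsub => hsub.antisymm ?_⟩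
  rintro a (rfl | rfl)
  · exact hT.1 (by simp)
  · exact hT.2 0 rfl

theorem notMem_of_isAnswerSet_groundExample {D : Set (Fin 3)} (hD : 1 ∈ D)
    {I : Set (GAtom (Fin 3) Bool)} (hI : IsAnswerSet (groundExample D) I) :
    (false, [0]) ∉ I := by
  simp only [IsAnswerSet, isModel_reduct_groundExample_iff] at hI
  obtain ⟨⟨-, hp⟩, hmin⟩ := hI
  have hdiff := hmin (I \ {(false, [0])})
    ⟨fun h => absurd (hp 1 hD) h, fun c hc => ⟨hp c hc, by simp⟩⟩ Set.sdiff_subset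
  intro h
  rw [← hdiff] at h
  exact h.2 rfl

theorem not_admissible_variableProgram : ¬ Admissible variableProgram {0} := by
  intro h
  obtain ⟨I, hI, hsub⟩ := h {(false, [0]), (true, [0])} (by
    rw [groundOn_variableProgram]
    exact isAnswerSet_groundExample_zero)
  rw [HU_variableProgram, groundOn_variableProgram] at hI
  exact notMem_of_isAnswerSet_groundExample (by simp) hI (hsub (by simp))

/-- There exist normal programs `P₁`, `P₂` with the same Herbrand universe and
identical full groundings, and a set `D` of constants with `D ⊆ HU(P₁)`, such that
`D` is an admissible diminution of `P₁` but not of `P₂`. -/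
theorem admissible_not_preserved_by_strong_equivalence :
    ∃ (P₁ P₂ : Set (GRule (VAtom (Fin 3) Unit Bool))) (D : Set (Fin 3)),
      P₁.Finite ∧ P₂.Finite ∧
      (∀ r ∈ P₁, ∃ a, r.head = {a}) ∧
      (∀ r ∈ P₂, ∃ a, r.head = {a}) ∧
      HU P₁ = HU P₂ ∧
      groundOn P₁ (HU P₁) = groundOn P₂ (HU P₂) ∧
      D ⊆ HU P₁ ∧
      Admissible P₁ D ∧ ¬ Admissible P₂ D := by
  refine ⟨constantProgram, variableProgram, {0}, by simp [constantProgram],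
    by simp [variableProgram], by simp [constantProgram, defaultRule, factRule],
    by simp [variableProgram, defaultRule, factRule],
    HU_constantProgram.trans HU_variableProgram.symm, ?_, by simp [HU_constantProgram],
    admissible_constantProgram _, not_admissible_variableProgram⟩
  rw [groundOn_constantProgram, groundOn_variableProgram, HU_variableProgram]

end ASP
end
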